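/- Let X be a nonseparable metric space that is nowhere locally compact (i.e., no point of X has a compact neighborhood). Then the set of bounded continuous real-valued functions on X that are nowhere locally uniformly continuous is not a Borel subset of the space C_b(X) of bounded continuous real-valued functions on X equipped with the supremum norm. -/

import Mathlib

open MeasureTheory
/-- A function is *nowhere locally uniformly continuous* if there is no point at which it has a
neighborhood on which it is uniformly continuous. -/
def NowhereLocallyUniformlyContinuous {X : Type*} [MetricSpace X] (f : X → ℝ) : Prop :=
  ∀ x : X, ¬ ∃ U ∈ nhds x, UniformContinuousOn f U

open Set Filter Topology Cardinal

theorem nluc_maxsep (X : Type*) [MetricSpace X] (s : ℝ) : ∃ D : Set X,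
    (∀ x ∈ D, ∀ y ∈ D, x ≠ y → s ≤ dist x y) ∧ ((0 < s) → ∀ x, ∃ d ∈ D, dist x d < s) := by
  obtain ⟨D, hD⟩ := zorn_subset {D : Set X | ∀ x ∈ D, ∀ y ∈ D, x ≠ y → s ≤ dist x y} (by
    intro c hc hchain
    refine ⟨⋃₀ c, ?_, fun t ht => subset_sUnion_of_mem ht⟩
    rintro x ⟨a, ha, hxa⟩ y ⟨b, hb, hyb⟩ hxy
    rcases hchain.total ha hb with h | h
    · exact hc hb x (h hxa) y hyb hxy
    · exact hc ha x hxa y (h hyb) hxy)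
  refine ⟨D, hD.prop, fun hs x => ?_⟩
  by_contra! hx
  have hx' : insert x D ∈ {D : Set X | ∀ x ∈ D, ∀ y ∈ D, x ≠ y → s ≤ dist x y} := by
    rintro a (rfl | ha) b (rfl | hb) hab
    · exact absurd rfl hab
    · exact hx b hb
    · rw [dist_comm]; exact hx a ha
    · exact hD.prop a ha b hb hab
  have := hD.le_of_ge hx' (subset_insert x D) (mem_insert x D)
  have := hx x this
  simp at this
  linarith

theorem nluc_nonborel : ∃ S : Set ℝ, ¬ MeasurableSet S ∧ #S ≤ ℵ₁ := by
  by_contra! h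
  have h1 : ℵ₁ ≤ #ℝ := by rw [mk_real]; exact aleph_one_le_continuum
  obtain ⟨A, hA⟩ := le_mk_iff_exists_set.1 h1
  have hsub : ∀ S : Set ℝ, S ⊆ A → MeasurableSet S := by
    intro S hS
    by_contra hm
    have := h S hm
    exact absurd ((mk_le_mk_of_subset hS).trans hA.le) (not_le.2 this)
  have hAm := hsub A subset_rfl
  have hunc : ¬ Countable A := by
    rw [← mk_le_aleph0_iff, hA, not_le]
    exact aleph_one_le_iff.1 le_rfl
  haveI : StandardBorelSpace A := hAm.standardBorel
  have e := PolishSpace.measurableEquivNatBoolOfNotCountable hunc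
  have hc : #A = 𝔠 := by
    rw [mk_congr e.toEquiv]; simp
  have h2 : #(Set A) ≤ #{ t : Set ℝ | MeasurableSet t } := by
    refine mk_le_of_injective (f := fun S : Set A => (⟨Subtype.val '' S, hsub _ (by simp)⟩ : { t : Set ℝ | MeasurableSet t })) ?_
    intro S T hST
    simp only [Subtype.mk.injEq] at hST
    exact Subtype.val_injective.image_injective hST
  have h3 : #{ t : Set ℝ | MeasurableSet t } ≤ 𝔠 := by
    rw [BorelSpace.measurable_eq (α := ℝ), Real.borel_eq_generateFrom_Ioo_rat]
    apply MeasurableSpace.cardinal_measurableSet_le_continuum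
    refine le_trans (b := ℵ₀) ?_ aleph0_le_continuum
    rw [mk_le_aleph0_iff]
    exact (Set.countable_iUnion fun a => Set.countable_iUnion fun b => Set.countable_iUnion fun _ => Set.countable_singleton _).to_subtype
  rw [mk_set, hc] at h2
  exact absurd (h2.trans h3) (not_le.2 (cantor _))

theorem nluc_pairs {X : Type*} [MetricSpace X]
    (hnlc : ∀ x : X, ¬ ∃ K ∈ nhds x, IsCompact K) (d : X) {r : ℝ} (hr : 0 < r) :
    ∃ A B : Set X, IsClosed A ∧ IsClosed B ∧ Disjoint A B ∧ A ⊆ Metric.ball d r ∧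
      B ⊆ Metric.ball d r ∧ ∀ δ > 0, ∃ x ∈ A, ∃ y ∈ B, dist x y < δ := by
  have hK : ¬ IsSeqCompact (Metric.closedBall d (r/4)) := by
    intro h
    exact hnlc d ⟨_, Metric.closedBall_mem_nhds d (by positivity), h.isCompact⟩
  unfold IsSeqCompact at hK
  push Not at hK
  obtain ⟨x, hxK, hx⟩ := hK
  have hx' : ∀ z, ∃ ρ > 0, {n | dist (x n) z < ρ}.Finite := by
    intro z
    by_contra! hz
    by_cases hzK : z ∈ Metric.closedBall d (r/4)
    · have hmc : MapClusterPt z atTop x := by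
        rw [mapClusterPt_iff_frequently]
        intro s hs
        obtain ⟨ρ, hρ, hs⟩ := Metric.mem_nhds_iff.1 hs
        rw [Nat.frequently_atTop_iff_infinite]
        exact (hz ρ hρ).mono fun n hn => hs hn
      obtain ⟨φ, hφ, hlim⟩ := TopologicalSpace.FirstCountableTopology.tendsto_subseq hmc
      exact hx z hzK φ hφ hlim
    · obtain ⟨ρ, hρ, hs⟩ := Metric.mem_nhds_iff.1 (Metric.isClosed_closedBall.isOpen_compl.mem_nhds hzK)
      obtain ⟨n, hn⟩ := (hz ρ hρ).nonempty
      exact hs hn (hxK n)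
  have hy : ∀ n, ∃ y, dist (x n) y < min (1/((n:ℝ)+1)) (r/4) ∧ ∀ m, x m ≠ y := by
    intro n
    obtain ⟨ρ, hρ, hfin⟩ := hx' (x n)
    have hpos : 0 < min ρ (min (1/((n:ℝ)+1)) (r/4)) := by positivity
    have hinf : (Metric.ball (x n) (min ρ (min (1/((n:ℝ)+1)) (r/4)))).Infinite := by
      intro hf
      exact hnlc (x n) ⟨_, Metric.ball_mem_nhds _ hpos, hf.isCompact⟩
    obtain ⟨y, hy, hyn⟩ := (hinf.diff (hfin.image x)).nonempty
    rw [Metric.mem_ball, lt_min_iff] at hy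
    refine ⟨y, by rw [dist_comm]; exact hy.2, ?_⟩
    rintro m rfl
    exact hyn ⟨m, hy.1, rfl⟩
  choose y hy hxy using hy
  have hclosed : ∀ w : ℕ → X, (∀ z, ∃ ρ > 0, {n | dist (w n) z < ρ}.Finite) → IsClosed (range w) := by
    intro w hw
    have : LocallyFinite (fun n => ({w n} : Set X)) := by
      intro z
      obtain ⟨ρ, hρ, hf⟩ := hw z
      refine ⟨Metric.ball z ρ, Metric.ball_mem_nhds _ hρ, hf.subset ?_⟩
      rintro n ⟨_, rfl, hn⟩
      exact hn
    have h2 := this.isClosed_iUnion (fun _ => isClosed_singleton)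
    rwa [iUnion_singleton_eq_range] at h2
  refine ⟨range x, range y, hclosed x hx', hclosed y ?_, ?_, ?_, ?_, ?_⟩
  · intro z
    obtain ⟨ρ, hρ, hf⟩ := hx' z
    obtain ⟨N, hN⟩ := exists_nat_one_div_lt (half_pos hρ)
    refine ⟨ρ/2, half_pos hρ, (hf.union (Set.finite_lt_nat N)).subset ?_⟩
    intro n hn
    simp only [mem_setOf_eq, mem_union] at hn ⊢
    by_cases hnN : n < N
    · exact Or.inr hnN
    · left
      have h1 := (lt_min_iff.1 (hy n)).1
      have h2 : 1/((n:ℝ)+1) ≤ 1/((N:ℝ)+1) := Nat.one_div_le_one_div (not_lt.1 hnN)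
      have := dist_triangle (x n) (y n) z
      linarith
  · rw [Set.disjoint_left]
    rintro _ ⟨m, rfl⟩ ⟨n, hn⟩
    exact hxy n m hn.symm
  · rintro _ ⟨m, rfl⟩
    have := hxK m
    rw [Metric.mem_closedBall] at this
    rw [Metric.mem_ball]; linarith
  · rintro _ ⟨m, rfl⟩
    have := hxK m
    rw [Metric.mem_closedBall] at this
    rw [Metric.mem_ball]
    have h1 := (lt_min_iff.1 (hy m)).2
    have := dist_triangle_left (y m) d (x m)
    linarith
  · intro δ hδ
    obtain ⟨N, hN⟩ := exists_nat_one_div_lt hδ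
    exact ⟨x N, ⟨N, rfl⟩, y N, ⟨N, rfl⟩, ((lt_min_iff.1 (hy N)).1).trans hN⟩

/-- oscillation at least `η` at arbitrarily small scales in `U` -/
def NlucOsc {X : Type*} [MetricSpace X] (f : X → ℝ) (U : Set X) (η : ℝ) : Prop :=
  ∀ δ > 0, ∃ x ∈ U, ∃ y ∈ U, dist x y < δ ∧ η ≤ |f x - f y|

theorem nluc_level {X : Type*} [MetricSpace X]
    (hnlc : ∀ x : X, ¬ ∃ K ∈ nhds x, IsCompact K) {s : ℝ} (hs : 0 < s) (D : Set X)
    (hD : ∀ x ∈ D, ∀ y ∈ D, x ≠ y → s ≤ dist x y) (f : BoundedContinuousFunction X ℝ)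
    {ε : ℝ} (hε : 0 < ε) :
    ∃ g : BoundedContinuousFunction X ℝ, dist g f ≤ ε ∧
      ∀ d ∈ D, NlucOsc g (Metric.ball d (s/4)) (ε/2) := by
  have hs4 : 0 < s/4 := by positivity
  choose A B hA hB hAB hAs hBs hclose using fun d : X => nluc_pairs hnlc d hs4
  classical
  let A' : D → Set X := fun d =>
    if NlucOsc f (Metric.ball d (s/4)) (ε/2) then Metric.closedBall d (s/4) else A d
  let B' : D → Set X := fun d =>
    if NlucOsc f (Metric.ball d (s/4)) (ε/2) then ∅ else B d
  have hA's : ∀ d : D, A' d ⊆ Metric.closedBall d (s/4) := by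
    intro d; dsimp only [A']; split_ifs
    · exact subset_rfl
    · exact (hAs _).trans Metric.ball_subset_closedBall
  have hB's : ∀ d : D, B' d ⊆ Metric.closedBall d (s/4) := by
    intro d; dsimp only [B']; split_ifs
    · exact empty_subset _
    · exact (hBs _).trans Metric.ball_subset_closedBall
  have hlf : LocallyFinite (fun d : D => Metric.closedBall (d:X) (s/4)) := by
    intro z
    refine ⟨Metric.ball z (s/4), Metric.ball_mem_nhds _ hs4, Set.Subsingleton.finite ?_⟩
    rintro a ⟨u, hu, hu'⟩ b ⟨v, hv, hv'⟩
    rw [Metric.mem_closedBall] at hu hv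
    rw [Metric.mem_ball] at hu' hv'
    by_contra hab
    have h1 := hD a a.2 b b.2 (fun h => hab (Subtype.ext h))
    have h3 := dist_triangle_left (a:X) z u
    have h4 := dist_triangle_left (b:X) z v
    have h5 := dist_triangle_right (a:X) b z
    linarith
  have hAc : IsClosed (⋃ d, A' d) := by
    refine (hlf.subset hA's).isClosed_iUnion fun d => ?_
    dsimp only [A']; split_ifs
    · exact Metric.isClosed_closedBall
    · exact hA _
  have hBc : IsClosed (⋃ d, B' d) := by
    refine (hlf.subset hB's).isClosed_iUnion fun d => ?_
    dsimp only [B']; split_ifs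
    · exact isClosed_empty
    · exact hB _
  have hdisj : Disjoint (⋃ d, A' d) (⋃ d, B' d) := by
    rw [Set.disjoint_left]
    intro z hz hz'
    obtain ⟨a, ha⟩ := mem_iUnion.1 hz
    obtain ⟨b, hb⟩ := mem_iUnion.1 hz'
    have hab : a = b := by
      by_contra hab
      have h1 := hD a a.2 b b.2 (fun h => hab (Subtype.ext h))
      have h3 := hA's a ha
      have h4 := hB's b hb
      rw [Metric.mem_closedBall] at h3 h4
      have h5 := dist_triangle_left (a:X) b z
      linarith
    subst hab
    dsimp only [A', B'] at ha hb
    split_ifs at ha hb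
    · exact hb
    · exact Set.disjoint_left.1 (hAB _) ha hb
  obtain ⟨u, hu0, hu1, hu⟩ := exists_bounded_zero_one_of_closed hAc hBc hdisj
  refine ⟨f + ε • u, ?_, ?_⟩
  · rw [BoundedContinuousFunction.dist_le hε.le]
    intro x
    simp only [BoundedContinuousFunction.coe_add, BoundedContinuousFunction.coe_smul, Pi.add_apply, Real.dist_eq, add_sub_cancel_left, smul_eq_mul]
    rw [abs_of_nonneg (mul_nonneg hε.le (hu x).1)]
    nlinarith [(hu x).2]
  · intro d hd
    by_cases hosc : NlucOsc f (Metric.ball d (s/4)) (ε/2)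
    · have hz : ∀ x ∈ Metric.ball d (s/4), u x = 0 := by
        intro x hx
        apply hu0
        refine mem_iUnion.2 ⟨⟨d, hd⟩, ?_⟩
        dsimp only [A']
        rw [if_pos hosc]
        exact Metric.ball_subset_closedBall hx
      intro δ hδ
      obtain ⟨x, hx, y, hy, h1, h2⟩ := hosc δ hδ
      refine ⟨x, hx, y, hy, h1, ?_⟩
      simpa [hz x hx, hz y hy] using h2
    · have hosc' := hosc
      unfold NlucOsc at hosc'
      push Not at hosc'
      obtain ⟨δ₀, hδ₀, hf⟩ := hosc'
      intro δ hδ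
      obtain ⟨x, hx, y, hy, hxy⟩ := hclose d (min δ δ₀) (lt_min hδ hδ₀)
      rw [lt_min_iff] at hxy
      have h1 := hf x (hAs d hx) y (hBs d hy) hxy.2
      refine ⟨x, hAs d hx, y, hBs d hy, hxy.1, ?_⟩
      have hux : u x = 0 := by
        apply hu0
        refine mem_iUnion.2 ⟨⟨d, hd⟩, ?_⟩
        dsimp only [A']
        rwa [if_neg hosc]
      have huy : u y = 1 := by
        apply hu1
        refine mem_iUnion.2 ⟨⟨d, hd⟩, ?_⟩
        dsimp only [B']
        rwa [if_neg hosc]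
      simp only [BoundedContinuousFunction.coe_add, BoundedContinuousFunction.coe_smul, Pi.add_apply, smul_eq_mul, hux, huy]
      rw [abs_lt] at h1
      rw [le_abs]
      right
      linarith [h1.1, h1.2]

theorem nluc_exists {X : Type*} [MetricSpace X]
    (hnlc : ∀ x : X, ¬ ∃ K ∈ nhds x, IsCompact K) :
    ∃ f : BoundedContinuousFunction X ℝ, NowhereLocallyUniformlyContinuous (f : X → ℝ) := by
  choose D hD hcov using fun n : ℕ => nluc_maxsep X (1/((n:ℝ)+1))
  let W : ℕ → Set (BoundedContinuousFunction X ℝ) := fun n =>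
    {f | ∃ η > 0, ∀ d ∈ D n, NlucOsc f (Metric.ball d (1/((n:ℝ)+1)/4)) η}
  have hdense : Dense (⋂ n, W n) := by
    apply dense_iInter_of_isOpen
    · intro n
      rw [Metric.isOpen_iff]
      rintro f ⟨η, hη, hf⟩
      refine ⟨η/4, by positivity, ?_⟩
      intro g hg
      refine ⟨η/2, by positivity, fun d hd δ hδ => ?_⟩
      obtain ⟨x, hx, y, hy, h1, h2⟩ := hf d hd δ hδ
      refine ⟨x, hx, y, hy, h1, ?_⟩
      have e1 := (BoundedContinuousFunction.dist_coe_le_dist (f := g) (g := f) x).trans_lt hg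
      have e2 := (BoundedContinuousFunction.dist_coe_le_dist (f := g) (g := f) y).trans_lt hg
      rw [Real.dist_eq, abs_lt] at e1 e2
      rw [le_abs] at h2 ⊢
      rcases h2 with h2 | h2
      · left; linarith [e1.1, e2.2]
      · right; linarith [e1.2, e2.1]
    · intro n
      rw [Metric.dense_iff]
      intro f ε hε
      obtain ⟨g, hg, hg'⟩ := nluc_level hnlc (by positivity) (D n) (hD n) f (half_pos hε)
      exact ⟨g, by rw [Metric.mem_ball]; linarith, ε/2/2, by positivity, hg'⟩
  obtain ⟨f, hf⟩ := hdense.nonempty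
  refine ⟨f, ?_⟩
  rintro x ⟨U, hU, huc⟩
  obtain ⟨R, hR, hRU⟩ := Metric.mem_nhds_iff.1 hU
  obtain ⟨n, hn⟩ := exists_nat_one_div_lt (half_pos hR)
  have hpos : 0 < 1/((n:ℝ)+1) := by positivity
  obtain ⟨d, hd, hxd⟩ := hcov n hpos x
  obtain ⟨η, hη, hosc⟩ := mem_iInter.1 hf n
  obtain ⟨δ, hδ, h⟩ := Metric.uniformContinuousOn_iff.1 huc η hη
  have hsub : Metric.ball d (1/((n:ℝ)+1)/4) ⊆ U := by
    intro z hz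
    apply hRU
    rw [Metric.mem_ball] at hz ⊢
    have := dist_triangle_right z x d
    linarith
  obtain ⟨a, ha, b, hb, h1, h2⟩ := hosc d hd δ hδ
  have := h a (hsub ha) b (hsub hb) h1
  rw [Real.dist_eq] at this
  linarith

theorem nluc_unc {X : Type*} [MetricSpace X] (hsep : ¬ TopologicalSpace.SeparableSpace X) :
    ∃ s > 0, ∃ D : Set X, (∀ x ∈ D, ∀ y ∈ D, x ≠ y → s ≤ dist x y) ∧ ¬ D.Countable := by
  choose D hD hcov using fun n : ℕ => nluc_maxsep X (1/((n:ℝ)+1))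
  by_contra! h
  apply hsep
  refine ⟨⟨⋃ n, D n, countable_iUnion fun n => h _ (by positivity) _ (hD n), ?_⟩⟩
  rw [Metric.dense_iff]
  intro x r hr
  obtain ⟨n, hn⟩ := exists_nat_one_div_lt hr
  obtain ⟨d, hd, hxd⟩ := hcov n (by positivity) x
  exact ⟨d, by rw [Metric.mem_ball, dist_comm]; linarith, mem_iUnion.2 ⟨n, hd⟩⟩

/-- For a nonseparable, nowhere locally compact metric space `X`, the set of bounded continuous
nowhere locally uniformly continuous real-valued functions on `X` is not a Borel subset of
`C_b(X)` with the supremum norm. -/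
theorem not_borel_nowhereLocallyUniformlyContinuous
    {X : Type*} [MetricSpace X]
    (hsep : ¬ TopologicalSpace.SeparableSpace X)
    (hnlc : ∀ x : X, ¬ ∃ K ∈ nhds x, IsCompact K) :
    ¬ MeasurableSet[borel (BoundedContinuousFunction X ℝ)]
      {f : BoundedContinuousFunction X ℝ | NowhereLocallyUniformlyContinuous (f : X → ℝ)} := by
  intro hmeas
  obtain ⟨g, hg⟩ := nluc_exists hnlc
  obtain ⟨s, hs, D, hD, hDunc⟩ := nluc_unc hsep
  obtain ⟨S, hSm, hScard⟩ := nluc_nonborel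
  have hSne : S.Nonempty := by
    rw [nonempty_iff_ne_empty]
    rintro rfl
    exact hSm MeasurableSet.empty
  have hcard : Cardinal.lift.{_, 0} #S ≤ Cardinal.lift.{0, _} #D := by
    have h1 : ℵ₁ ≤ #D := by
      rw [← not_lt, ← Cardinal.countable_iff_lt_aleph_one]; exact hDunc
    rw [Cardinal.lift_uzero]
    refine le_trans ?_ h1
    exact (Cardinal.lift_le.2 hScard).trans_eq (by simp)
  obtain ⟨e⟩ := Cardinal.lift_mk_le'.1 hcard
  haveI : Nonempty S := hSne.to_subtype
  let φ : D → S := Function.invFun e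
  have hφ : Function.Surjective φ := Function.invFun_surjective e.injective
  let E : Set (ℝ × X) := {p | ∃ d : D, p.1 = φ d ∧ dist p.2 d ≤ s/4}
  have hEne : E.Nonempty := by
    obtain ⟨d, -⟩ := hφ (Classical.arbitrary S)
    exact ⟨(φ d, d), d, rfl, by simp; positivity⟩
  let h : ℝ → X → ℝ := fun y x => min 1 (Metric.infDist (y, x) E)
  have hlip : LipschitzWith 1 (fun p : ℝ × X => min 1 (Metric.infDist p E)) :=
    (Metric.lipschitz_infDist_pt E).const_min 1
  have h0 : ∀ y x, 0 ≤ h y x := fun y x => le_min zero_le_one Metric.infDist_nonneg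
  have h1 : ∀ y x, h y x ≤ 1 := fun y x => min_le_left _ _
  have hlx : ∀ y x x', |h y x - h y x'| ≤ dist x x' := by
    intro y x x'
    have := hlip.dist_le_mul (y, x) (y, x')
    simpa [Real.dist_eq, Prod.dist_eq] using this
  have hly : ∀ y y' x, |h y x - h y' x| ≤ dist y y' := by
    intro y y' x
    have := hlip.dist_le_mul (y, x) (y', x)
    simpa [Real.dist_eq, Prod.dist_eq] using this
  have hcx : ∀ y, UniformContinuous (h y) := by
    intro y
    exact (hlip.uniformContinuous).comp (uniformContinuous_const.prodMk uniformContinuous_id)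
  let H : ℝ → BoundedContinuousFunction X ℝ := fun y =>
    BoundedContinuousFunction.ofNormedAddCommGroup (h y) (hcx y).continuous 1 (fun x => by
      rw [Real.norm_eq_abs, abs_of_nonneg (h0 y x)]; exact h1 y x)
  have hH : Continuous H := by
    refine (LipschitzWith.of_dist_le_mul (K := 1) fun y y' => ?_).continuous
    rw [BoundedContinuousFunction.dist_le (by positivity)]
    intro x
    simpa [H, Real.dist_eq] using hly y y' x
  have hΦ : Continuous (fun y => H y * g) := hH.mul continuous_const
  have hpre : MeasurableSet ((fun y => H y * g) ⁻¹' {f : BoundedContinuousFunction X ℝ | NowhereLocallyUniformlyContinuous (f : X → ℝ)}) := by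
    borelize (BoundedContinuousFunction X ℝ)
    exact hΦ.measurable hmeas
  apply hSm
  convert hpre.compl using 1
  ext y
  simp only [mem_compl_iff, mem_preimage, mem_setOf_eq]
  constructor
  · intro hy hn
    obtain ⟨d, hd⟩ := hφ ⟨y, hy⟩
    refine hn d ⟨Metric.closedBall d (s/4), Metric.closedBall_mem_nhds _ (by positivity), ?_⟩
    have hz : EqOn (fun _ => (0:ℝ)) (H y * g : BoundedContinuousFunction X ℝ) (Metric.closedBall (d:X) (s/4)) := by
      intro x hx
      have hmem : (y, x) ∈ E := ⟨d, by simp [hd], hx⟩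
      have : h y x = 0 := by
        simp [h, Metric.infDist_zero_of_mem hmem]
      simp [H, this]
    exact (uniformContinuous_const.uniformContinuousOn).congr hz
  · intro hn
    by_contra hy
    apply hn
    have hpos : ∀ x, 0 < h y x := by
      intro x
      have hfar : ∃ c > 0, ∀ p ∈ E, c ≤ dist (y, x) p := by
        by_cases hx : ∃ d : D, dist x d < s/2
        · obtain ⟨d, hd⟩ := hx
          have hyd : 0 < dist y (φ d) := dist_pos.2 (fun h => hy (h ▸ (φ d).2))
          refine ⟨min (dist y (φ d)) (s/4), lt_min hyd (by positivity), ?_⟩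
          rintro ⟨a, z⟩ ⟨d', h1, h2⟩
          dsimp only at h1 h2
          rw [Prod.dist_eq]
          by_cases hdd : d' = d
          · subst hdd
            rw [h1]
            exact (min_le_left _ _).trans (le_max_left _ _)
          · refine (min_le_right _ _).trans (le_trans ?_ (le_max_right _ _))
            have h3 := hD d' d'.2 d d.2 (fun h => hdd (Subtype.ext h))
            have h4 := dist_triangle_left (d':X) d x
            have h5 := dist_triangle x z d'
            dsimp only
            linarith
        · push Not at hx
          refine ⟨s/4, by positivity, ?_⟩
          rintro ⟨a, z⟩ ⟨d', h1, h2⟩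
          dsimp only at h1 h2
          rw [Prod.dist_eq]
          refine (le_trans ?_ (le_max_right _ _))
          have h4 := hx d'
          have h5 := dist_triangle x z d'
          dsimp only
          linarith
      obtain ⟨c, hc, hcE⟩ := hfar
      exact lt_min one_pos (hc.trans_le ((Metric.le_infDist hEne).2 fun p hp => hcE p hp))
    rintro x ⟨U, hU, huc⟩
    have hV : {z | h y x / 2 < h y z} ∈ 𝓝 x :=
      (isOpen_lt continuous_const (hcx y).continuous).mem_nhds (half_lt_self (hpos x))
    apply hg x
    refine ⟨U ∩ {z | h y x / 2 < h y z}, inter_mem hU hV, ?_⟩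
    set c := h y x / 2 with hcdef
    have hc : 0 < c := half_pos (hpos x)
    rw [Metric.uniformContinuousOn_iff] at huc ⊢
    intro ε hε
    set M := ‖g‖ + 1 with hM
    have hMpos : 0 < M := by positivity
    obtain ⟨δ, hδ, hd⟩ := huc (c * ε / 2) (by positivity)
    refine ⟨min δ (c * ε / 2 / M), lt_min hδ (by positivity), ?_⟩
    rintro a ⟨haU, ha⟩ b ⟨hbU, hb⟩ hab
    rw [lt_min_iff] at hab
    have k1 := hd a haU b hbU hab.1
    have k2 := hlx y a b
    have k3 : |g b| ≤ M := by
      have := g.norm_coe_le_norm b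
      rw [Real.norm_eq_abs] at this
      linarith
    simp only [H, BoundedContinuousFunction.coe_mul, Pi.mul_apply, Real.dist_eq, BoundedContinuousFunction.coe_ofNormedAddCommGroup] at k1
    rw [Real.dist_eq]
    have k4 : h y a * (g a - g b) = (h y a * g a - h y b * g b) - (h y a - h y b) * g b := by ring
    have k5 : |h y a * (g a - g b)| < c * ε := by
      rw [k4]
      refine (abs_sub _ _).trans_lt ?_
      have : |(h y a - h y b) * g b| ≤ c * ε / 2 := by
        rw [abs_mul]
        calc _ ≤ (c * ε / 2 / M) * M := by
              gcongr
              exact k2.trans hab.2.le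
          _ = _ := by field_simp
      linarith
    rw [abs_mul, abs_of_nonneg (h0 y a)] at k5
    have k6 : c * |g a - g b| ≤ h y a * |g a - g b| := by
      gcongr
      exact le_of_lt ha
    exact lt_of_mul_lt_mul_left (k6.trans_lt k5) hc.le
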